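/- Let a_1,...,a_{q−1} in F_{q^m}^* with N_{F_{q^m}/F_q}(a_i) ≠ N_{F_{q^m}/F_q}(a_j) for i ≠ j, and let H_1,...,H_μ be F_q-subspaces of F_{q^m}. Then F_{q^m}^* = ∪_{i=1}^{q−1} { a_i β^{q−1} : β in (∪_{j=1}^μ H_j) \ {0} } if, and only if, ∪_{j=1}^μ H_j = F_{q^m}. -/

import Mathlib

/-- The field norm `N_{F_{q^m}/F_q}(x) = x · x^q ⋯ x^{q^{m-1}}`. -/
def fieldNorm (q m : ℕ) {F : Type*} [Field F] (x : F) : F :=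
  ∏ i ∈ Finset.range m, x ^ q ^ i

theorem fieldNorm_eq_pow (q m : ℕ) {F : Type*} [Field F] (x : F) :
    fieldNorm q m x = x ^ (∑ i ∈ Finset.range m, q ^ i) := by
  rw [fieldNorm, Finset.prod_pow_eq_pow_sum]

/-- An injective family of `n` many `n`-th roots of unity exhausts all of them. -/
theorem exists_eq_of_injective_of_pow_eq_one {F ι : Type*} [Field F] [Finite ι] {n : ℕ}
    (hn : 0 < n) (hι : Nat.card ι = n) (f : ι → F) (hf : Function.Injective f)
    (hf1 : ∀ i, f i ^ n = 1) {z : F} (hz : z ^ n = 1) : ∃ i, f i = z := by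
  classical
  have := Fintype.ofFinite ι
  have hsub : Finset.univ.image f ⊆ Polynomial.nthRootsFinset n (1 : F) := by
    intro y hy
    obtain ⟨i, -, rfl⟩ := Finset.mem_image.mp hy
    exact (Polynomial.mem_nthRootsFinset hn 1).mpr (hf1 i)
  have hcard : (Polynomial.nthRootsFinset n (1 : F)).card ≤ (Finset.univ.image f).card := by
    rw [Finset.card_image_of_injective _ hf, Finset.card_univ, ← Nat.card_eq_fintype_card, hι,
      Polynomial.nthRootsFinset]
    exact (Multiset.toFinset_card_le _).trans (Polynomial.card_nthRoots n 1)
  have hmem : z ∈ Finset.univ.image f := by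
    rw [Finset.eq_of_subset_of_card_le hsub hcard]
    exact (Polynomial.mem_nthRootsFinset hn 1).mpr hz
  simpa using hmem

theorem pow_natCard_sub_one_eq_one {K : Type*} [Field K] [Finite K] {x : K} (hx : x ≠ 0) :
    x ^ (Nat.card K - 1) = 1 := by
  have := Fintype.ofFinite K
  rw [Nat.card_eq_fintype_card]
  exact FiniteField.pow_card_sub_one_eq_one x hx

theorem Subfield.mem_of_pow_natCard_sub_one_eq_one {F : Type*} [Field F] [Finite F]
    (K : Subfield F) {z : F} (hz : z ^ (Nat.card K - 1) = 1) : z ∈ K := by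
  have hK : 1 < Nat.card K := Finite.one_lt_card
  obtain ⟨u, hu⟩ := exists_eq_of_injective_of_pow_eq_one (ι := Kˣ) (by omega)
    (Nat.card_units K) (fun u => ((u : K) : F))
    (fun u v h => Units.ext (Subtype.ext h))
    (fun u => by
      exact_mod_cast congrArg (fun t : K => (t : F)) (pow_natCard_sub_one_eq_one u.ne_zero)) hz
  exact hu ▸ (u : K).2

/-- In the cyclic group `Fˣ` of order `s * n`, the kernel of the `s`-th power map consists of
`n`-th powers. -/
theorem exists_eq_pow_of_pow_eq_one {F : Type*} [Field F] [Finite F] {s n : ℕ}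
    (hsn : s * n = Nat.card F - 1) {y : F} (hy0 : y ≠ 0) (hy : y ^ s = 1) :
    ∃ b : F, b ≠ 0 ∧ y = b ^ n := by
  obtain ⟨g, hg⟩ := IsCyclic.exists_generator (α := Fˣ)
  have hord : orderOf g = s * n := by
    rw [orderOf_eq_card_of_forall_mem_zpowers hg, Nat.card_units, hsn]
  have hpos : 0 < s * n := hord ▸ orderOf_pos g
  obtain ⟨k, hk⟩ := (mem_powers_iff_mem_zpowers (y := Units.mk0 y hy0)).mpr (hg _)
  have hk' : g ^ k = Units.mk0 y hy0 := hk
  have h1 : g ^ (k * s) = 1 := by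
    rw [pow_mul, hk']
    exact Units.ext (by simpa using hy)
  have h2 : s * n ∣ s * k := by
    rw [← hord, mul_comm s k]
    exact orderOf_dvd_of_pow_eq_one h1
  obtain ⟨c, rfl⟩ := Nat.dvd_of_mul_dvd_mul_left (Nat.pos_of_mul_pos_right hpos) h2
  refine ⟨(g ^ c : Fˣ), Units.ne_zero _, ?_⟩
  rw [← Units.val_pow_eq_pow_val, ← pow_mul, mul_comm c n, hk', Units.val_mk0]

/-- **Lemma.**  Let `a : Fin (q-1) → F_{q^m}` have nonzero entries with pairwise distinct
norms, and let `H 1, ..., H μ` be `F_q`-subspaces of `F_{q^m}`.  Then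
`F_{q^m}^* = ⋃_{i=1}^{q-1} { a_i β^{q-1} : β ∈ (⋃_j H j) \ {0} }` if and only if
`⋃_j H j = F_{q^m}`. -/
theorem union_of_norm_orbits_eq_units_iff
    {q m μ : ℕ} {F : Type*} [Field F] [Finite F]
    (Fq : Subfield F) (hq : Nat.card Fq = q) (hF : Nat.card F = q ^ m)
    (a : Fin (q - 1) → F) (ha0 : ∀ i, a i ≠ 0)
    (haN : ∀ i j, i ≠ j → fieldNorm q m (a i) ≠ fieldNorm q m (a j))
    (H : Fin μ → Submodule Fq F) :
    {x : F | x ≠ 0} =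
        {x : F | ∃ (i : Fin (q - 1)) (β : F),
          (∃ j : Fin μ, β ∈ H j) ∧ β ≠ 0 ∧ x = a i * β ^ (q - 1)}
      ↔ (⋃ j : Fin μ, (H j : Set F)) = Set.univ := by
  have hq1 : 1 < q := hq ▸ Finite.one_lt_card
  have hn : 0 < q - 1 := by omega
  set s := ∑ i ∈ Finset.range m, q ^ i with hs
  have hsn : s * (q - 1) = Nat.card F - 1 := by
    rw [hF, hs]
    have := geom_sum_mul_add (q - 1) m
    rw [Nat.sub_add_cancel hq1.le] at this
    omega
  have hpow : ∀ x : F, x ≠ 0 → (x ^ s) ^ (q - 1) = 1 := fun x hx => by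
    rw [← pow_mul, hsn, pow_natCard_sub_one_eq_one hx]
  have hinj : Function.Injective fun i => a i ^ s := fun i j hij => by
    by_contra hne
    exact haN i j hne (by simpa only [fieldNorm_eq_pow] using hij)
  constructor
  · intro h
    refine Set.eq_univ_of_forall fun β => Set.mem_iUnion.mpr ?_
    by_cases hβ : β = 0
    · have h1 : (1 : F) ∈ {x : F | x ≠ 0} := one_ne_zero
      rw [h] at h1
      obtain ⟨-, -, ⟨j, -⟩, -⟩ := h1
      exact ⟨j, hβ ▸ (H j).zero_mem⟩
    · let i₀ : Fin (q - 1) := ⟨0, hn⟩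
      have hx : a i₀ * β ^ (q - 1) ∈ {x : F | x ≠ 0} :=
        mul_ne_zero (ha0 i₀) (pow_ne_zero _ hβ)
      rw [h] at hx
      obtain ⟨i, γ, ⟨j, hj⟩, hγ, hx⟩ := hx
      have hi : i₀ = i := hinj <| by
        have := congrArg (· ^ s) hx
        simpa only [mul_pow, pow_right_comm _ (q - 1) s, hpow _ hβ, hpow _ hγ, mul_one] using this
      rw [← hi] at hx
      have hpe : β ^ (q - 1) = γ ^ (q - 1) := mul_left_cancel₀ (ha0 i₀) hx
      have hmem : β / γ ∈ Fq := Fq.mem_of_pow_natCard_sub_one_eq_one <| by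
        rw [hq, div_pow, hpe, div_self (pow_ne_zero _ hγ)]
      refine ⟨j, ?_⟩
      have := (H j).smul_mem (⟨β / γ, hmem⟩ : Fq) hj
      rwa [Subfield.smul_def, smul_eq_mul, div_mul_cancel₀ _ hγ] at this
  · intro h
    ext x
    constructor
    · intro hx
      obtain ⟨i, hi⟩ := exists_eq_of_injective_of_pow_eq_one hn (Nat.card_fin _) _ hinj
        (fun i => hpow _ (ha0 i)) (hpow x hx)
      obtain ⟨β, hβ, hxβ⟩ := exists_eq_pow_of_pow_eq_one hsn (div_ne_zero hx (ha0 i)) <| by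
        rw [div_pow, ← hi, div_self (pow_ne_zero _ (ha0 i))]
      refine ⟨i, β, Set.mem_iUnion.mp (h ▸ Set.mem_univ β), hβ, ?_⟩
      rw [← hxβ, mul_div_cancel₀ _ (ha0 i)]
    · rintro ⟨i, β, -, hβ, rfl⟩
      exact mul_ne_zero (ha0 i) (pow_ne_zero _ hβ)
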